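/- arXiv:math/0209034 — 2 statements merged into one kernel-verified Lean document; each statement's English description precedes it below -/
import Mathlib

section
/- Let Z be a topological space, ι a finite index set, and U : ι → Set Z an injective family of subsets of Z such that each U i is open, nonempty and connected. Let a : ι → ℤ satisfy a i ≠ 0 for every i, and suppose that the function ∑ i, (a i) • χ_{U i} is identically zero on Z. If there exist indices j ≠ k such that U j and U k overlap, then there exist indices p ≠ q such that U p and U q overlap and a p and a q have the same sign (i.e., a p * a q > 0). -/
/-- χ_S, the indicator function of a set `S`, valued in `ℤ`. -/
noncomputable def chiInd {Z : Type*} (S : Set Z) : Z → ℤ := S.indicator fun _ => 1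

/-- Two sets overlap if they intersect and neither is contained in the other. -/
def Overlap {Z : Type*} (A B : Set Z) : Prop :=
  (A ∩ B).Nonempty ∧ (A \ B).Nonempty ∧ (B \ A).Nonempty

theorem subset_or_subset_of_not_overlap {Z : Type*} {A B : Set Z} (h : ¬ Overlap A B)
    (hAB : (A ∩ B).Nonempty) : A ⊆ B ∨ B ⊆ A := by
  by_contra! hsub
  exact h ⟨hAB, Set.sdiff_nonempty.2 hsub.1, Set.sdiff_nonempty.2 hsub.2⟩

/-- In a vanishing combination of indicators with nonzero coefficients, every point of one of the
sets also lies in a set whose coefficient has the opposite sign. -/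
theorem exists_mem_mul_neg_of_sum_chiInd_eq_zero {Z ι : Type*} [Fintype ι] {U : ι → Set Z}
    {a : ι → ℤ} {z : Z} (hsum : (∑ i, a i • chiInd (U i)) z = 0) {i : ι} (hi : a i ≠ 0)
    (hz : z ∈ U i) : ∃ l, z ∈ U l ∧ a i * a l < 0 := by
  by_contra! h
  have hzero : ∑ l, a i * (a l * chiInd (U l) z) = 0 := by
    rw [← Finset.mul_sum]
    simp only [Finset.sum_apply, Pi.smul_apply, smul_eq_mul] at hsum
    rw [hsum, mul_zero]
  have hnonneg : ∀ l ∈ Finset.univ, 0 ≤ a i * (a l * chiInd (U l) z) := by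
    intro l _
    by_cases hl : z ∈ U l
    · simpa [chiInd, hl] using h l hl
    · simp [chiInd, hl]
  have hterm := (Finset.sum_eq_zero_iff_of_nonneg hnonneg).1 hzero i (Finset.mem_univ i)
  simp [chiInd, hz, hi] at hterm

theorem stmt0 {Z : Type*} [TopologicalSpace Z] {ι : Type*} [Fintype ι]
    (U : ι → Set Z) (hinj : Function.Injective U)
    (hopen : ∀ i, IsOpen (U i)) (hne : ∀ i, (U i).Nonempty)
    (hconn : ∀ i, IsPreconnected (U i))
    (a : ι → ℤ) (ha : ∀ i, a i ≠ 0)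
    (hsum : ∀ z : Z, (∑ i, a i • chiInd (U i)) z = 0)
    (hoverlap : ∃ j k, j ≠ k ∧ Overlap (U j) (U k)) :
    ∃ p q, p ≠ q ∧ Overlap (U p) (U q) ∧ a p * a q > 0 := by
  obtain ⟨j, -⟩ := hoverlap
  by_contra! h
  have hlam : ∀ k l, 0 < a k * a l → (U k ∩ U l).Nonempty → U k ⊆ U l ∨ U l ⊆ U k := by
    intro k l hkl hmeet
    refine subset_or_subset_of_not_overlap (fun hov ↦ ?_) hmeet
    have hne' : k ≠ l := by
      rintro rfl
      simp [Overlap] at hov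
    exact (h k l hne' hov).not_gt hkl
  obtain ⟨i, -, hmax⟩ := Finset.exists_maximalFor U Finset.univ ⟨j, Finset.mem_univ j⟩
  obtain ⟨x, hx⟩ := hne i
  obtain ⟨k₀, hk₀⟩ := exists_mem_mul_neg_of_sum_chiInd_eq_zero (hsum x) (ha i) hx
  obtain ⟨k, ⟨hxk, hik⟩, hkmax⟩ := (Set.toFinite {l | x ∈ U l ∧ a i * a l < 0}).exists_maximalFor
    U _ ⟨k₀, hk₀⟩
  have hsub : U i ⊆ U k := by
    refine IsPreconnected.subset_left_of_subset_union (hopen k)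
      (v := ⋃ l ∈ {l | a i * a l < 0 ∧ ¬ U l ⊆ U k}, U l)
      (isOpen_biUnion fun l _ ↦ hopen l) ?_ ?_ ⟨x, hx, hxk⟩ (hconn i)
    · rw [Set.disjoint_iUnion₂_right]
      rintro l ⟨hil, hlk⟩
      by_contra hdis
      have hkl : 0 < a k * a l := by
        have hpos : 0 < a i ^ 2 * (a k * a l) := by
          linarith [mul_pos_of_neg_of_neg hik hil]
        exact pos_of_mul_pos_right hpos (sq_nonneg _)
      rcases hlam k l hkl (Set.not_disjoint_iff_nonempty_inter.1 hdis) with hle | hle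
      · exact hlk (hkmax ⟨hle hxk, hil⟩ hle)
      · exact hlk hle
    · intro y hy
      obtain ⟨l, hyl, hil⟩ := exists_mem_mul_neg_of_sum_chiInd_eq_zero (hsum y) (ha i) hy
      by_cases hlk : U l ⊆ U k
      · exact Or.inl (hlk hyl)
      · exact Or.inr (Set.mem_biUnion (show l ∈ {l | _} from ⟨hil, hlk⟩) hyl)
  obtain rfl : i = k := hinj (hsub.antisymm (hmax (Finset.mem_univ k) hsub))
  exact (mul_self_nonneg (a i)).not_gt hik
end

section
/- Let Z be a topological space, ι a finite index set, and U : ι → Set Z an injective family of subsets of Z such that each U i is open, nonempty and connected. Let a : ι → ℤ satisfy a i ≠ 0 for every i, and suppose that the function ∑ i, (a i) • χ_{U i} is identically zero on Z. If no two of the sets overlap, i.e., for all j ≠ k either U j ∩ U k = ∅, or U j ⊆ U k, or U k ⊆ U j, then the index set ι is empty. -/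
/-- In a finite laminar family of nonempty open preconnected sets, no member is covered by its proper
subsets in the family. -/
theorem exists_mem_forall_ssubset_notMem {Z : Type*} [TopologicalSpace Z] {ι : Type*} [Finite ι]
    (U : ι → Set Z) (hopen : ∀ i, IsOpen (U i)) (hne : ∀ i, (U i).Nonempty)
    (hconn : ∀ i, IsPreconnected (U i))
    (hno : ∀ j k, j ≠ k → U j ∩ U k = ∅ ∨ U j ⊆ U k ∨ U k ⊆ U j) (i : ι) :
    ∃ z ∈ U i, ∀ j, U j ⊂ U i → z ∉ U j := by
  by_contra! h
  obtain ⟨w, hw⟩ := hne i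
  obtain ⟨j₀, hj₀, -⟩ := h w hw
  obtain ⟨j, hj, hmax⟩ :=
    (Set.toFinite {j | U j ⊂ U i}).exists_maximalFor U _ ⟨j₀, hj₀⟩
  simp only [Set.mem_ofPred_eq] at hj hmax
  let V : Set Z := ⋃ k ∈ {k | U k ∩ U j = ∅}, U k
  have hV : IsOpen V := isOpen_biUnion fun k _ => hopen k
  have hdisj : ∀ z ∈ U j, z ∉ V := by
    intro z hz hzV
    obtain ⟨k, hk, hzk⟩ := Set.mem_iUnion₂.1 hzV
    exact (Set.eq_empty_iff_forall_notMem.1 hk z) ⟨hzk, hz⟩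
  have hcov : U i ⊆ U j ∪ V := by
    intro z hz
    obtain ⟨k, hk, hzk⟩ := h z hz
    by_cases hkj : k = j
    · exact Or.inl (hkj ▸ hzk)
    rcases hno k j hkj with he | hs | hs
    · exact Or.inr (Set.mem_biUnion (show k ∈ {k | U k ∩ U j = ∅} from he) hzk)
    · exact Or.inl (hs hzk)
    · exact Or.inl (hmax hk hs hzk)
  obtain ⟨y, hyi, hyj⟩ := Set.exists_of_ssubset hj
  obtain ⟨x, hx⟩ := hne j
  obtain ⟨z, -, hzj, hzV⟩ := hconn i (U j) V (hopen j) hV hcov ⟨x, hj.subset hx, hx⟩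
    ⟨y, hyi, (hcov hyi).resolve_left hyj⟩
  exact hdisj z hzj hzV

theorem stmt1 {Z : Type*} [TopologicalSpace Z] {ι : Type*} [Fintype ι]
    (U : ι → Set Z) (hinj : Function.Injective U)
    (hopen : ∀ i, IsOpen (U i)) (hne : ∀ i, (U i).Nonempty)
    (hconn : ∀ i, IsPreconnected (U i))
    (a : ι → ℤ) (ha : ∀ i, a i ≠ 0)
    (hsum : ∀ z : Z, (∑ i, a i • chiInd (U i)) z = 0)
    (hno : ∀ j k, j ≠ k → U j ∩ U k = ∅ ∨ U j ⊆ U k ∨ U k ⊆ U j) :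
    IsEmpty ι := by
  by_contra hι
  rw [not_isEmpty_iff] at hι
  obtain ⟨i, -, hmax⟩ := (Set.toFinite (Set.univ : Set ι)).exists_maximalFor U _ Set.univ_nonempty
  obtain ⟨z, hz, hzj⟩ := exists_mem_forall_ssubset_notMem U hopen hne hconn hno i
  have honly : ∀ j, j ≠ i → z ∉ U j := by
    intro j hji hzU
    rcases hno j i hji with he | hs | hs
    · exact Set.eq_empty_iff_forall_notMem.1 he z ⟨hzU, hz⟩
    · exact hzj j (hs.ssubset_of_ne (hinj.ne hji)) hzU
    · exact hji (hinj ((hmax (Set.mem_univ j) hs).antisymm hs))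
  have hs := hsum z
  rw [Finset.sum_apply, Finset.sum_eq_single i
    (fun j _ hj => by simp [chiInd, honly j hj]) (by simp)] at hs
  exact ha i (by simpa [chiInd, hz] using hs)
end
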